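/- (Quantitative trace inequality) Let B₁' be the unit ball in ℝ^{d−1}, p ∈ [2,∞), and u ∈ W¹_p(B₁' × (0,1)). Then for every x_d ∈ (0,1), ‖u(·, x_d)‖_{L_p(B₁')} ≤ N x_d^{1/2 − 1/p} ‖u‖_{W¹_p(B₁' × (0, x_d))}, where N = N(p) > 0. In particular, ‖u(·, x_d)‖_{L_p(B₁')} → 0 as x_d → 0⁺. -/

import Mathlib

open MeasureTheory Real Filter Topology

noncomputable section

/-- Space-time points `z = (t, x)` with `x ∈ ℝ^{d+1}`. -/
abbrev Pt (d : ℕ) := ℝ × (Fin (d + 1) → ℝ)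

/-- The last (vertical) coordinate `x_d` of a point of `ℝ^{d+1}`. -/
def xdC (d : ℕ) (x : Fin (d + 1) → ℝ) : ℝ := x (Fin.last d)

/-- Euclidean ball in `ℝ^n`. -/
def eball (n : ℕ) (c : Fin n → ℝ) (r : ℝ) : Set (Fin n → ℝ) :=
  {x | ∑ i, (x i - c i) ^ 2 < r ^ 2}

/-- The upper half space `ℝ^{d+1}_+ = {x : x_d > 0}`. -/
def upperHalf (d : ℕ) : Set (Fin (d + 1) → ℝ) := {x | 0 < xdC d x}

/-- The space-time domain `Ω_T = (-∞, T) × ℝ^{d+1}_+`. -/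
def OmegaT (d : ℕ) (T : EReal) : Set (Pt d) := {z | (z.1 : EReal) < T ∧ 0 < xdC d z.2}

/-- Upper half ball `B_r^+(x₀)`. -/
def Bplus (d : ℕ) (r : ℝ) (x₀ : Fin (d + 1) → ℝ) : Set (Fin (d + 1) → ℝ) :=
  eball (d + 1) x₀ r ∩ upperHalf d

/-- The parabolic upper half cylinder `Q_r^+(z₀) = (t₀ - r, t₀] × B_r^+(x₀)`. -/
def Qplus (d : ℕ) (r : ℝ) (z₀ : Pt d) : Set (Pt d) :=
  {z | z.1 ∈ Set.Ioc (z₀.1 - r) z₀.1 ∧ z.2 ∈ Bplus d r z₀.2}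

/-- The full cylinder `Q_r(z₀) = (t₀ - r, t₀] × B_r(x₀)`. -/
def Qfull (d : ℕ) (r : ℝ) (z₀ : Pt d) : Set (Pt d) :=
  {z | z.1 ∈ Set.Ioc (z₀.1 - r) z₀.1 ∧ z.2 ∈ eball (d + 1) z₀.2 r}

/-- Spatial partial derivative `D_i u`. -/
def pd (d : ℕ) (i : Fin (d + 1)) (u : Pt d → ℝ) (z : Pt d) : ℝ :=
  fderiv ℝ (fun x => u (z.1, x)) z.2 (Pi.single i 1)

/-- Time derivative `u_t`. -/
def td (d : ℕ) (u : Pt d → ℝ) (z : Pt d) : ℝ :=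
  deriv (fun t => u (t, z.2)) z.1

/-- `|Du|²`, the squared length of the spatial gradient. -/
def gradSq (d : ℕ) (u : Pt d → ℝ) (z : Pt d) : ℝ := ∑ i, (pd d i u z) ^ 2

/-- `|D²u|²`, the squared length of the spatial Hessian. -/
def hessSq (d : ℕ) (u : Pt d → ℝ) (z : Pt d) : ℝ :=
  ∑ i, ∑ j, (pd d i (pd d j u) z) ^ 2

/-- Tangential derivative in the `i`-th horizontal direction. -/
def tang (d : ℕ) (i : Fin d) (u : Pt d → ℝ) : Pt d → ℝ := pd d i.castSucc u

/-- Iterated tangential derivative along a multi-index `v`. -/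
def multiTang (d : ℕ) {k : ℕ} (v : Fin k → Fin d) (u : Pt d → ℝ) : Pt d → ℝ :=
  (List.ofFn v).foldr (fun i f => tang d i f) u

/-- Test functions on `E`: smooth, compactly supported inside `E`. -/
def IsTest (d : ℕ) (E : Set (Pt d)) (φ : Pt d → ℝ) : Prop :=
  ContDiff ℝ (⊤ : ℕ∞) φ ∧ HasCompactSupport φ ∧ tsupport φ ⊆ E

/-- Membership in the space `𝔰H¹_p(E)`: `x_d^{-1/2} u, Du ∈ L_p(E)` and
`u_t = x_d D_i F_i + g` distributionally with `F ∈ L_p(E)^d`, `g ∈ L_p(E, x_d^{-p/2})`. -/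
def MemSH (d : ℕ) (p : ℝ) (E : Set (Pt d)) (u : Pt d → ℝ) : Prop :=
  (∀ z ∈ E, DifferentiableAt ℝ (fun x => u (z.1, x)) z.2) ∧
  IntegrableOn (fun z => |u z| ^ p * (xdC d z.2) ^ (-(p / 2))) E ∧
  IntegrableOn (fun z => (gradSq d u z) ^ (p / 2)) E ∧
  ∃ (F : Fin (d + 1) → Pt d → ℝ) (g : Pt d → ℝ),
    (∀ i, IntegrableOn (fun z => |F i z| ^ p) E) ∧
    IntegrableOn (fun z => |g z| ^ p * (xdC d z.2) ^ (-(p / 2))) E ∧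
    ∀ φ : Pt d → ℝ, IsTest d E φ →
      -∫ z in E, u z * td d φ z =
        (∑ i, -∫ z in E, F i z * pd d i (fun w => xdC d w.2 * φ w) z) +
          ∫ z in E, g z * φ z

/-- Weighted `L_p` norm. -/
def LpW (d : ℕ) (p : ℝ) (E : Set (Pt d)) (w : Pt d → ℝ) (g : Pt d → ℝ) : ℝ :=
  (∫ z in E, |g z| ^ p * w z) ^ (1 / p)

/-- `L_p` norm of the spatial gradient. -/
def LpGrad (d : ℕ) (p : ℝ) (E : Set (Pt d)) (u : Pt d → ℝ) : ℝ :=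
  (∫ z in E, (gradSq d u z) ^ (p / 2)) ^ (1 / p)

/-- `L_p` norm of a vector field. -/
def LpVec (d : ℕ) (p : ℝ) (E : Set (Pt d)) (F : Fin (d + 1) → Pt d → ℝ) : ℝ :=
  (∫ z in E, (∑ i, (F i z) ^ 2) ^ (p / 2)) ^ (1 / p)

/-- The weight `x_d^{-p/2}`. -/
def wNeg (d : ℕ) (p : ℝ) : Pt d → ℝ := fun z => (xdC d z.2) ^ (-(p / 2))

/-- Ellipticity and boundedness of `(a_{ij})` on `E`. -/
def EllipticOn (d : ℕ) (ν : ℝ) (E : Set (Pt d))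
    (a : Fin (d + 1) → Fin (d + 1) → Pt d → ℝ) : Prop :=
  ∀ z ∈ E, (∀ ξ : Fin (d + 1) → ℝ, ν * ∑ i, ξ i ^ 2 ≤ ∑ i, ∑ j, a i j z * ξ i * ξ j) ∧
    ∀ i j, |a i j z| ≤ ν⁻¹

/-- Bounds `ν ≤ c ≤ ν⁻¹` on `E`. -/
def BoundedOn (d : ℕ) (ν : ℝ) (E : Set (Pt d)) (c : Pt d → ℝ) : Prop :=
  ∀ z ∈ E, ν ≤ c z ∧ c z ≤ ν⁻¹

/-- Ellipticity and boundedness for coefficients depending only on `x_d > 0`. -/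
def EllipticXd (d : ℕ) (ν : ℝ) (a : Fin (d + 1) → Fin (d + 1) → ℝ → ℝ) : Prop :=
  ∀ s : ℝ, 0 < s →
    (∀ ξ : Fin (d + 1) → ℝ, ν * ∑ i, ξ i ^ 2 ≤ ∑ i, ∑ j, a i j s * ξ i * ξ j) ∧
    ∀ i j, |a i j s| ≤ ν⁻¹

/-- Bounds `ν ≤ g ≤ ν⁻¹` for a coefficient depending only on `x_d > 0`. -/
def BoundedXd (ν : ℝ) (g : ℝ → ℝ) : Prop := ∀ s : ℝ, 0 < s → ν ≤ g s ∧ g s ≤ ν⁻¹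

/-- The structural condition: `ā_{id}` is constant for each `i`. -/
def ConstLastCol (d : ℕ) (a : Fin (d + 1) → Fin (d + 1) → ℝ → ℝ) : Prop :=
  ∀ i, ∀ s t : ℝ, 0 < s → 0 < t → a i (Fin.last d) s = a i (Fin.last d) t

/-- Weak solution of `u_t + λ c₀ u - x_d D_i(a_{ij} D_j u - F_i) = √λ f` on `E`. -/
def IsWeakSolMain (d : ℕ) (E : Set (Pt d)) (a : Fin (d + 1) → Fin (d + 1) → Pt d → ℝ)
    (c₀ : Pt d → ℝ) (lam : ℝ) (F : Fin (d + 1) → Pt d → ℝ) (f u : Pt d → ℝ) : Prop :=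
  ∀ φ : Pt d → ℝ, IsTest d E φ →
    (∫ z in E, (xdC d z.2)⁻¹ * (-(u z) * td d φ z + lam * c₀ z * u z * φ z)) +
      (∫ z in E, ∑ i, ((∑ j, a i j z * pd d j u z) - F i z) * pd d i φ z) =
      Real.sqrt lam * ∫ z in E, (xdC d z.2)⁻¹ * f z * φ z

/-- Weak solution of `x_d^{-1}(a₀ u_t + λ c₀ u) - D_i(a_{ij} D_j u - F_i) = √λ x_d^{-1} f`. -/
def IsWeakSolA0 (d : ℕ) (E : Set (Pt d)) (a0 : (Fin (d + 1) → ℝ) → ℝ) (c₀ : Pt d → ℝ)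
    (a : Fin (d + 1) → Fin (d + 1) → Pt d → ℝ) (lam : ℝ) (F : Fin (d + 1) → Pt d → ℝ)
    (f u : Pt d → ℝ) : Prop :=
  ∀ φ : Pt d → ℝ, IsTest d E φ →
    (∫ z in E, (xdC d z.2)⁻¹ * (-(a0 z.2) * u z * td d φ z + lam * c₀ z * u z * φ z)) +
      (∫ z in E, ∑ i, ((∑ j, a i j z * pd d j u z) - F i z) * pd d i φ z) =
      Real.sqrt lam * ∫ z in E, (xdC d z.2)⁻¹ * f z * φ z

/-- Weak solution of `𝓛₀[u] = D_i F_i + √λ x_d^{-1} f` for coefficients depending on `x_d`. -/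
def IsWeakSolL0 (d : ℕ) (E : Set (Pt d)) (a0 c0 : ℝ → ℝ)
    (a : Fin (d + 1) → Fin (d + 1) → ℝ → ℝ) (lam : ℝ) (F : Fin (d + 1) → Pt d → ℝ)
    (f u : Pt d → ℝ) : Prop :=
  ∀ φ : Pt d → ℝ, IsTest d E φ →
    (∫ z in E, (xdC d z.2)⁻¹ *
        (-(a0 (xdC d z.2)) * u z * td d φ z + lam * c0 (xdC d z.2) * u z * φ z)) +
      (∫ z in E, ∑ i, ((∑ j, a i j (xdC d z.2) * pd d j u z) - F i z) * pd d i φ z) =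
      Real.sqrt lam * ∫ z in E, (xdC d z.2)⁻¹ * f z * φ z

/-- Weak solution of the homogeneous equation `𝓛₀[u] = 0`. -/
def IsWeakSolL0Hom (d : ℕ) (E : Set (Pt d)) (a0 c0 : ℝ → ℝ)
    (a : Fin (d + 1) → Fin (d + 1) → ℝ → ℝ) (lam : ℝ) (u : Pt d → ℝ) : Prop :=
  ∀ φ : Pt d → ℝ, IsTest d E φ →
    (∫ z in E, (xdC d z.2)⁻¹ *
        (-(a0 (xdC d z.2)) * u z * td d φ z + lam * c0 (xdC d z.2) * u z * φ z)) +
      (∫ z in E, ∑ i, (∑ j, a i j (xdC d z.2) * pd d j u z) * pd d i φ z) = 0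

/-- The lower dimensional cylinder `Q'_ρ(z₀') = (t₀-ρ, t₀] × B'_ρ(x₀')`. -/
def Qprime (d : ℕ) (ρ : ℝ) (z₀ : Pt d) : Set (ℝ × (Fin d → ℝ)) :=
  {w | w.1 ∈ Set.Ioc (z₀.1 - ρ) z₀.1 ∧ w.2 ∈ eball d (fun i => z₀.2 i.castSucc) ρ}

/-- Average of a coefficient over `Q'_ρ(z₀')` at height `x_d = s`. -/
def sliceAvg (d : ℕ) (ρ : ℝ) (z₀ : Pt d) (g : Pt d → ℝ) (s : ℝ) : ℝ :=
  ⨍ w in Qprime d ρ z₀, g (w.1, Fin.snoc w.2 s)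

/-- The averaged coefficient `[a_{ij}]_{ρ,z₀}(x_d)`. -/
def coefAvg (d : ℕ) (ρ : ℝ) (z₀ : Pt d) (a : Fin (d + 1) → Fin (d + 1) → Pt d → ℝ)
    (i j : Fin (d + 1)) (s : ℝ) : ℝ :=
  if j = Fin.last d then ⨍ z in Qplus d ρ z₀, a i j z else sliceAvg d ρ z₀ (a i j) s

/-- The partial mean oscillation `a^#_ρ(z₀)`. -/
def aSharp (d : ℕ) (a : Fin (d + 1) → Fin (d + 1) → Pt d → ℝ) (c₀ : Pt d → ℝ)
    (ρ : ℝ) (z₀ : Pt d) : ℝ :=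
  (⨆ i, ⨆ j, ⨍ z in Qplus d ρ z₀, |a i j z - coefAvg d ρ z₀ a i j (xdC d z.2)|) +
    ⨍ z in Qplus d ρ z₀, |c₀ z - sliceAvg d ρ z₀ c₀ (xdC d z.2)|

/-- Spatial partial derivative for time-independent functions. -/
def pdS (d : ℕ) (i : Fin (d + 1)) (u : (Fin (d + 1) → ℝ) → ℝ) (x : Fin (d + 1) → ℝ) : ℝ :=
  fderiv ℝ u x (Pi.single i 1)

/-- `|Du|²` for time-independent functions. -/
def gradSqS (d : ℕ) (u : (Fin (d + 1) → ℝ) → ℝ) (x : Fin (d + 1) → ℝ) : ℝ :=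
  ∑ i, (pdS d i u x) ^ 2

/-- The spatial cylinder `B₁' × (0, h)`. -/
def CylD (d : ℕ) (h : ℝ) : Set (Fin (d + 1) → ℝ) :=
  {x | (fun i : Fin d => x i.castSucc) ∈ eball d 0 1 ∧ xdC d x ∈ Set.Ioo 0 h}

/-- Membership in the weighted Sobolev space `W¹_p(D)`. -/
def MemW1p (d : ℕ) (p : ℝ) (D : Set (Fin (d + 1) → ℝ)) (u : (Fin (d + 1) → ℝ) → ℝ) : Prop :=
  (∀ x ∈ D, DifferentiableAt ℝ u x) ∧
  IntegrableOn (fun x => |u x| ^ p * (xdC d x) ^ (-(p / 2))) D ∧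
  IntegrableOn (fun x => (gradSqS d u x) ^ (p / 2)) D

/-- The `W¹_p(D)` norm. -/
def W1pNorm (d : ℕ) (p : ℝ) (D : Set (Fin (d + 1) → ℝ)) (u : (Fin (d + 1) → ℝ) → ℝ) : ℝ :=
  (∫ x in D, |u x| ^ p * (xdC d x) ^ (-(p / 2))) ^ (1 / p) +
    (∫ x in D, (gradSqS d u x) ^ (p / 2)) ^ (1 / p)


theorem Real.add_rpow_le_two_rpow_mul {a b p : ℝ} (ha : 0 ≤ a) (hb : 0 ≤ b) (hp : 1 ≤ p) :
    (a + b) ^ p ≤ 2 ^ p * (a ^ p + b ^ p) := by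
  have h := NNReal.rpow_add_le_mul_rpow_add_rpow ⟨a, ha⟩ ⟨b, hb⟩ hp
  have h' : (a + b) ^ p ≤ 2 ^ (p - 1) * (a ^ p + b ^ p) := by exact_mod_cast h
  refine h'.trans ?_
  have : (2 : ℝ) ^ (p - 1) ≤ 2 ^ p := Real.rpow_le_rpow_of_exponent_le (by norm_num) (by linarith)
  gcongr

/-- Pointwise bound of a function at `s` by its average over `(0, s)` and that of its derivative. -/
theorem abs_rpow_le_integral_add_integral {p s : ℝ} (hp : 2 ≤ p) (hs : s ∈ Set.Ioo (0 : ℝ) 1)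
    {v v' G : ℝ → ℝ} (hv : ∀ t ∈ Set.Ioc 0 s, HasDerivAt v (v' t) t)
    (hG : ∀ t ∈ Set.Ioo 0 s, |v' t| ^ p ≤ G t) (hGi : IntegrableOn G (Set.Ioo 0 s))
    (hF : IntegrableOn (fun t => |v t| ^ p * t ^ (-(p / 2))) (Set.Ioo 0 s)) :
    |v s| ^ p ≤ 2 ^ p * s ^ (p / 2 - 1) *
      ((∫ t in Set.Ioo 0 s, |v t| ^ p * t ^ (-(p / 2))) + ∫ t in Set.Ioo 0 s, G t) := by
  obtain ⟨hs0, hs1⟩ := hs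
  have hp0 : 0 < p := by linarith
  have hvm : AEStronglyMeasurable v' (volume.restrict (Set.Ioo 0 s)) := by
    refine (measurable_deriv v).aestronglyMeasurable.congr ?_
    filter_upwards [ae_restrict_mem measurableSet_Ioo] with t ht
    exact (hv t ⟨ht.1, ht.2.le⟩).deriv
  have hpi : IntegrableOn (fun t => |v' t| ^ p) (Set.Ioo 0 s) := by
    refine Integrable.mono' hGi ?_ ?_
    · exact (hvm.aemeasurable.abs.pow_const p).aestronglyMeasurable
    · filter_upwards [ae_restrict_mem measurableSet_Ioo] with t ht
      rw [Real.norm_of_nonneg (by positivity)]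
      exact hG t ht
  have hvi : IntegrableOn v' (Set.Ioo 0 s) := by
    refine Integrable.mono' ((integrableOn_const (C := (1 : ℝ)) (by simp)).add hpi) hvm ?_
    filter_upwards with t
    simp only [Pi.add_apply, Real.norm_eq_abs]
    rcases le_total |v' t| 1 with h | h
    · have : 0 ≤ |v' t| ^ p := by positivity
      linarith
    · have := Real.self_le_rpow_of_one_le h (by linarith : 1 ≤ p)
      linarith
  set I := ∫ t in Set.Ioo 0 s, |v' t|
  have hI0 : 0 ≤ I := integral_nonneg fun _ => abs_nonneg _
  have hJ : I ^ p ≤ s ^ (p - 1) * ∫ t in Set.Ioo 0 s, G t := by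
    have h := (convexOn_rpow (by linarith : 1 ≤ p)).map_set_average_le
      (μ := volume) (t := Set.Ioo 0 s) (f := fun t => |v' t|)
      (Real.continuous_rpow_const hp0.le).continuousOn isClosed_Ici (by simp [hs0]) (by simp)
      (by simp) hvi.abs hpi
    simp only [setAverage_eq, smul_eq_mul, Measure.real, Real.volume_Ioo, sub_zero,
      ENNReal.toReal_ofReal hs0.le] at h
    have hGm : ∫ t in Set.Ioo 0 s, |v' t| ^ p ≤ ∫ t in Set.Ioo 0 s, G t :=
      setIntegral_mono_on hpi hGi measurableSet_Ioo hG
    rw [Real.mul_rpow (by positivity) hI0, Real.inv_rpow hs0.le, inv_mul_le_iff₀ (by positivity),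
      ← mul_assoc, ← Real.rpow_neg_one s, ← Real.rpow_add hs0, ← sub_eq_add_neg] at h
    exact h.trans (by gcongr)
  have key : ∀ r ∈ Set.Ioo 0 s, |v s| ^ p ≤
      2 ^ p * (s ^ (p / 2) * (|v r| ^ p * r ^ (-(p / 2))) + I ^ p) := by
    intro r ⟨hr0, hrs⟩
    have hsub : Set.Ioo r s ⊆ Set.Ioo 0 s := Set.Ioo_subset_Ioo_left hr0.le
    have hftc := intervalIntegral.integral_eq_sub_of_hasDerivAt (a := r) (b := s)
      (f := v) (f' := v')
      (fun x hx => by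
        rw [Set.uIcc_of_le hrs.le] at hx
        exact hv x ⟨hr0.trans_le hx.1, hx.2⟩)
      (by rw [intervalIntegrable_iff_integrableOn_Ioo_of_le hrs.le]; exact hvi.mono_set hsub)
    have hd : |v s - v r| ≤ I := by
      rw [← hftc, intervalIntegral.integral_of_le hrs.le, integral_Ioc_eq_integral_Ioo]
      refine (abs_integral_le_integral_abs).trans ?_
      exact setIntegral_mono_set hvi.abs (ae_of_all _ fun _ => abs_nonneg _) hsub.eventuallyLE
    have hle : |v s| ≤ |v r| + I := by
      have := abs_sub_abs_le_abs_sub (v s) (v r)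
      linarith
    have hw : |v r| ^ p ≤ s ^ (p / 2) * (|v r| ^ p * r ^ (-(p / 2))) := by
      have h1 : 1 ≤ s ^ (p / 2) * r ^ (-(p / 2)) := by
        rw [Real.rpow_neg hr0.le, ← div_eq_mul_inv, one_le_div (by positivity)]
        gcongr
      have h2 : 0 ≤ |v r| ^ p := by positivity
      nlinarith
    calc |v s| ^ p ≤ (|v r| + I) ^ p := by gcongr
      _ ≤ 2 ^ p * (|v r| ^ p + I ^ p) :=
        Real.add_rpow_le_two_rpow_mul (abs_nonneg _) hI0 (by linarith)
      _ ≤ _ := by gcongr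
  have hint : s * |v s| ^ p ≤
      2 ^ p * (s ^ (p / 2) * (∫ t in Set.Ioo 0 s, |v t| ^ p * t ^ (-(p / 2))) + s * I ^ p) := by
    have hc : IntegrableOn (fun _ : ℝ => I ^ p) (Set.Ioo 0 s) := integrableOn_const (by simp)
    have h := setIntegral_mono_on (μ := volume) (integrableOn_const (by simp))
      (((hF.const_mul (s ^ (p / 2))).add hc).const_mul (2 ^ p)) measurableSet_Ioo key
    simp only [Pi.add_apply] at h
    rw [integral_const_mul, integral_add (hF.const_mul _) hc, integral_const_mul] at h
    simpa [hs0.le] using h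
  have hA0 : 0 ≤ ∫ t in Set.Ioo 0 s, G t :=
    setIntegral_nonneg measurableSet_Ioo fun t ht => le_trans (by positivity) (hG t ht)
  have hpow : s ^ (p / 2) = s * s ^ (p / 2 - 1) := by
    rw [← Real.rpow_one_add' hs0.le (by linarith)]; congr 1; ring
  have hpow' : s ^ (p - 1) ≤ s ^ (p / 2 - 1) :=
    Real.rpow_le_rpow_of_exponent_ge hs0 hs1.le (by linarith)
  have hI : I ^ p ≤ s ^ (p / 2 - 1) * ∫ t in Set.Ioo 0 s, G t := hJ.trans (by gcongr)
  rw [hpow] at hint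
  refine le_of_mul_le_mul_left (hint.trans ?_) hs0
  calc _ ≤ 2 ^ p * (s * s ^ (p / 2 - 1) * (∫ t in Set.Ioo 0 s, |v t| ^ p * t ^ (-(p / 2)))
        + s * (s ^ (p / 2 - 1) * ∫ t in Set.Ioo 0 s, G t)) := by gcongr
    _ = _ := by ring

theorem eball_measurableSet (n : ℕ) (c : Fin n → ℝ) (r : ℝ) : MeasurableSet (eball n c r) :=
  measurableSet_lt (by fun_prop) (by fun_prop)

theorem eball_volume_lt_top (n : ℕ) (c : Fin n → ℝ) (r : ℝ) : volume (eball n c r) < ⊤ := by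
  refine lt_of_le_of_lt (measure_mono (t := Metric.closedBall c |r|) fun x hx => ?_)
    measure_closedBall_lt_top
  rw [Metric.mem_closedBall, dist_pi_le_iff (abs_nonneg r)]
  intro i
  rw [Real.dist_eq, ← sq_le_sq]
  exact (Finset.single_le_sum (f := fun i => (x i - c i) ^ 2) (fun _ _ => sq_nonneg _)
    (Finset.mem_univ i)).trans (le_of_lt hx)

/-- The measurable equivalence `(t, y) ↦ (y, t)` of `ℝ × ℝ^d` with `ℝ^{d+1}`. -/
def snocEquiv (d : ℕ) : ℝ × (Fin d → ℝ) ≃ᵐ (Fin (d + 1) → ℝ) :=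
  (MeasurableEquiv.piFinSuccAbove (fun _ => ℝ) (Fin.last d)).symm

theorem snocEquiv_apply (d : ℕ) (z : ℝ × (Fin d → ℝ)) :
    snocEquiv d z = (Fin.snoc z.2 z.1 : Fin (d + 1) → ℝ) :=
  Fin.insertNth_last' z.1 z.2

theorem measurePreserving_snocEquiv (d : ℕ) :
    MeasurePreserving (snocEquiv d) (volume.prod volume) volume :=
  (volume_preserving_piFinSuccAbove (fun _ : Fin (d + 1) => ℝ) (Fin.last d)).symm

theorem snoc_mem_CylD {d : ℕ} {h t : ℝ} {y : Fin d → ℝ} :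
    (Fin.snoc y t : Fin (d + 1) → ℝ) ∈ CylD d h ↔ y ∈ eball d 0 1 ∧ t ∈ Set.Ioo 0 h := by
  simp [CylD, xdC]

theorem snocEquiv_preimage_CylD (d : ℕ) (h : ℝ) :
    snocEquiv d ⁻¹' CylD d h = Set.Ioo 0 h ×ˢ eball d 0 1 := by
  ext z
  rw [Set.mem_preimage, snocEquiv_apply, snoc_mem_CylD, Set.mem_prod, and_comm]

theorem CylD_subset {d : ℕ} {s t : ℝ} (h : s ≤ t) : CylD d s ⊆ CylD d t :=
  fun _ hx => ⟨hx.1, hx.2.1, hx.2.2.trans_le h⟩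

theorem volume_CylD (d : ℕ) (h : ℝ) :
    volume (CylD d h) = ENNReal.ofReal h * volume (eball d 0 1) := by
  rw [← (measurePreserving_snocEquiv d).measure_preimage_equiv, snocEquiv_preimage_CylD,
    Measure.prod_prod, Real.volume_Ioo, sub_zero]

theorem tendsto_setIntegral_CylD {d : ℕ} {f : (Fin (d + 1) → ℝ) → ℝ}
    (hf : IntegrableOn f (CylD d 1)) :
    Tendsto (fun s => ∫ x in CylD d s, f x) (𝓝[>] 0) (𝓝 0) := by
  have hvol : Tendsto (fun s => volume (CylD d s)) (𝓝[>] 0) (𝓝 0) := by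
    simp_rw [volume_CylD]
    have h : Tendsto (fun s : ℝ => ENNReal.ofReal s) (𝓝[>] 0) (𝓝 0) := by
      simpa using (ENNReal.continuous_ofReal.tendsto 0).mono_left nhdsWithin_le_nhds
    simpa using ENNReal.Tendsto.mul_const h (Or.inr (eball_volume_lt_top d 0 1).ne)
  have h := Integrable.tendsto_setIntegral_nhds_zero hf (s := fun s => CylD d s)
    (tendsto_of_tendsto_of_tendsto_of_le_of_le tendsto_const_nhds hvol (fun _ => zero_le)
      fun s => Measure.restrict_apply_le _ _)
  refine h.congr' ?_
  filter_upwards [Ioo_mem_nhdsGT one_pos] with s hs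
  rw [Measure.restrict_restrict_of_subset (CylD_subset hs.2.le)]

theorem gradSqS_nonneg (d : ℕ) (u : (Fin (d + 1) → ℝ) → ℝ) (x : Fin (d + 1) → ℝ) :
    0 ≤ gradSqS d u x :=
  Finset.sum_nonneg fun _ _ => sq_nonneg _

theorem abs_pdS_rpow_le {d : ℕ} {p : ℝ} (hp : 0 ≤ p) (i : Fin (d + 1))
    (u : (Fin (d + 1) → ℝ) → ℝ) (x : Fin (d + 1) → ℝ) :
    |pdS d i u x| ^ p ≤ gradSqS d u x ^ (p / 2) := by
  have h : |pdS d i u x| ^ p = (pdS d i u x ^ 2) ^ (p / 2) := by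
    rw [← sq_abs, ← Real.rpow_natCast, ← Real.rpow_mul (abs_nonneg _)]
    congr 1
    push_cast
    ring
  rw [h]
  refine Real.rpow_le_rpow (sq_nonneg _) ?_ (by positivity)
  exact Finset.single_le_sum (f := fun i => pdS d i u x ^ 2) (fun _ _ => sq_nonneg _)
    (Finset.mem_univ i)

theorem hasDerivAt_snoc {d : ℕ} (y : Fin d → ℝ) (t : ℝ) :
    HasDerivAt (fun t => (Fin.snoc y t : Fin (d + 1) → ℝ)) (Pi.single (Fin.last d) 1) t := by
  rw [hasDerivAt_pi]
  intro i
  refine Fin.lastCases ?_ (fun j => ?_) i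
  · simpa using hasDerivAt_id' t
  · simpa [(Fin.castSucc_lt_last j).ne] using hasDerivAt_const t (y j)

theorem MemW1p.integral_slice_le {d : ℕ} {p s : ℝ} (hp : 2 ≤ p) (hs : s ∈ Set.Ioo (0 : ℝ) 1)
    {u : (Fin (d + 1) → ℝ) → ℝ} (hu : MemW1p d p (CylD d 1) u) :
    ∫ y in eball d 0 1, |u (Fin.snoc y s)| ^ p ≤ 2 ^ p * s ^ (p / 2 - 1) *
      ((∫ x in CylD d s, |u x| ^ p * xdC d x ^ (-(p / 2))) +
        ∫ x in CylD d s, gradSqS d u x ^ (p / 2)) := by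
  obtain ⟨hd, hF, hG⟩ := hu
  have hsub : CylD d s ⊆ CylD d 1 := CylD_subset hs.2.le
  have hprod : ∀ {f : (Fin (d + 1) → ℝ) → ℝ}, IntegrableOn f (CylD d 1) →
      Integrable (fun z : ℝ × (Fin d → ℝ) => f (Fin.snoc z.2 z.1))
        ((volume.restrict (Set.Ioo 0 s)).prod (volume.restrict (eball d 0 1))) ∧
      ∫ x in CylD d s, f x =
        ∫ y in eball d 0 1, ∫ t in Set.Ioo 0 s, f (Fin.snoc y t) := by
    intro f hf
    have h1 : Integrable (fun z : ℝ × (Fin d → ℝ) => f (Fin.snoc z.2 z.1))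
        ((volume.restrict (Set.Ioo 0 s)).prod (volume.restrict (eball d 0 1))) := by
      rw [Measure.prod_restrict, ← snocEquiv_preimage_CylD]
      have := ((measurePreserving_snocEquiv d).integrableOn_comp_preimage
        (snocEquiv d).measurableEmbedding).2 (hf.mono_set hsub)
      simpa only [IntegrableOn, Function.comp_def, snocEquiv_apply] using this
    refine ⟨h1, ?_⟩
    rw [← integral_prod_symm (fun z : ℝ × (Fin d → ℝ) => f (Fin.snoc z.2 z.1)) h1,
      Measure.prod_restrict, ← snocEquiv_preimage_CylD,
      ← (measurePreserving_snocEquiv d).setIntegral_preimage_emb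
        (snocEquiv d).measurableEmbedding]
    simp only [snocEquiv_apply]
  obtain ⟨hFi, hFe⟩ := hprod hF
  obtain ⟨hGi, hGe⟩ := hprod hG
  rw [hFe, hGe, ← integral_add hFi.integral_prod_right hGi.integral_prod_right,
    ← integral_const_mul]
  refine integral_mono_of_nonneg (ae_of_all _ fun y => by positivity)
    ((hFi.integral_prod_right.add hGi.integral_prod_right).const_mul _) ?_
  filter_upwards [hFi.prod_left_ae, hGi.prod_left_ae,
    ae_restrict_mem (eball_measurableSet d 0 1)] with y hFy hGy hy
  have hx : ∀ t : ℝ, xdC d (Fin.snoc y t) = t := fun t => by simp [xdC]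
  simp only [hx] at hFy ⊢
  refine abs_rpow_le_integral_add_integral hp hs (v := fun t => u (Fin.snoc y t))
    (v' := fun t => pdS d (Fin.last d) u (Fin.snoc y t)) (fun t ht => ?_)
    (fun t _ => abs_pdS_rpow_le (by linarith) _ _ _) hGy hFy
  exact (hd _ (snoc_mem_CylD.2 ⟨hy, ht.1, ht.2.trans_lt hs.2⟩)).hasFDerivAt.comp_hasDerivAt t
    (hasDerivAt_snoc y t)

theorem MemW1p.norm_slice_le {d : ℕ} {p s : ℝ} (hp : 2 ≤ p) (hs : s ∈ Set.Ioo (0 : ℝ) 1)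
    {u : (Fin (d + 1) → ℝ) → ℝ} (hu : MemW1p d p (CylD d 1) u) :
    (∫ y in eball d 0 1, |u (Fin.snoc y s)| ^ p) ^ (1 / p) ≤
      2 * s ^ ((1 : ℝ) / 2 - 1 / p) * W1pNorm d p (CylD d s) u := by
  have hp0 : 0 < p := by linarith
  have hs0 := hs.1
  have hF0 : 0 ≤ ∫ x in CylD d s, |u x| ^ p * xdC d x ^ (-(p / 2)) := by
    rw [← (measurePreserving_snocEquiv d).setIntegral_preimage_emb
      (snocEquiv d).measurableEmbedding, snocEquiv_preimage_CylD]
    refine setIntegral_nonneg (measurableSet_Ioo.prod (eball_measurableSet d 0 1)) fun z hz => ?_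
    have : 0 ≤ xdC d (snocEquiv d z) := by simpa [snocEquiv_apply, xdC] using hz.1.1.le
    positivity
  have hG0 : 0 ≤ ∫ x in CylD d s, gradSqS d u x ^ (p / 2) :=
    integral_nonneg fun x => Real.rpow_nonneg (gradSqS_nonneg d u x) _
  have h := Real.rpow_le_rpow (integral_nonneg fun y => by positivity)
    (hu.integral_slice_le hp hs) (by positivity : 0 ≤ 1 / p)
  refine h.trans ?_
  rw [Real.mul_rpow (by positivity) (by positivity), Real.mul_rpow (by positivity) (by positivity),
    ← Real.rpow_mul (by norm_num), ← Real.rpow_mul hs0.le, mul_one_div_cancel hp0.ne',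
    Real.rpow_one, show (p / 2 - 1) * (1 / p) = 1 / 2 - 1 / p by field_simp]
  unfold W1pNorm
  gcongr
  exact Real.rpow_add_le_add_rpow hF0 hG0 (by positivity) (by rw [div_le_one hp0]; linarith)

/-- quantitative trace inequality:
`‖u(·, x_d)‖_{L_p(B₁')} ≤ N x_d^{1/2 - 1/p} ‖u‖_{W¹_p(B₁' × (0, x_d))}`, and the slice norms
tend to `0` as `x_d → 0⁺`. -/
theorem statement16 (p : ℝ) (hp : 2 ≤ p) :
    ∃ N : ℝ, 0 < N ∧
      ∀ (d : ℕ) (u : (Fin (d + 1) → ℝ) → ℝ),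
        MemW1p d p (CylD d 1) u →
        (∀ s ∈ Set.Ioo (0 : ℝ) 1,
          (∫ y in eball d 0 1, |u (Fin.snoc y s)| ^ p) ^ (1 / p) ≤
            N * s ^ ((1 : ℝ) / 2 - 1 / p) * W1pNorm d p (CylD d s) u) ∧
        Tendsto (fun s : ℝ => (∫ y in eball d 0 1, |u (Fin.snoc y s)| ^ p) ^ (1 / p))
          (𝓝[>] (0 : ℝ)) (𝓝 0) := by
  have hp0 : 0 < p := by linarith
  refine ⟨2, two_pos, fun d u hu => ⟨fun s hs => hu.norm_slice_le hp hs, ?_⟩⟩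
  have hW : Tendsto (fun s => W1pNorm d p (CylD d s) u) (𝓝[>] 0) (𝓝 0) := by
    have hpos : 0 < 1 / p := by positivity
    have h := ((tendsto_setIntegral_CylD hu.2.1).rpow_const (p := 1 / p) (Or.inr hpos.le)).add
      ((tendsto_setIntegral_CylD hu.2.2).rpow_const (p := 1 / p) (Or.inr hpos.le))
    rwa [Real.zero_rpow hpos.ne', add_zero] at h
  refine tendsto_of_tendsto_of_tendsto_of_le_of_le' tendsto_const_nhds
    (by simpa using hW.const_mul 2) ?_ ?_
  · exact Eventually.of_forall fun s =>
      Real.rpow_nonneg (integral_nonneg fun y => by positivity) _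
  · filter_upwards [Ioo_mem_nhdsGT one_pos] with s hs
    have hle := hu.norm_slice_le hp hs
    have h1 : s ^ ((1 : ℝ) / 2 - 1 / p) ≤ 1 := by
      refine Real.rpow_le_one hs.1.le hs.2.le (sub_nonneg.2 ?_)
      exact one_div_le_one_div_of_le two_pos hp
    have hW0 : 0 ≤ W1pNorm d p (CylD d s) u := by
      have hpos : 0 < 2 * s ^ ((1 : ℝ) / 2 - 1 / p) := by
        have := hs.1
        positivity
      refine nonneg_of_mul_nonneg_right (le_trans ?_ hle) hpos
      exact Real.rpow_nonneg (integral_nonneg fun y => by positivity) _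
    refine hle.trans ?_
    gcongr
    linarith

end
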